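/- arXiv:2503.01401 — 5 statements merged into one kernel-verified Lean document; each statement's English description precedes it below -/
import Mathlib

section
/- Let k₁, k₂ be positive reals with k₁ ≠ k₂, and let A₀, A₁, A₂, A₃ ∈ ℂ (representing ψ(0), ψ'(0), ψ''(0), ψ'''(0)). There exist r₁, r₂ ∈ ℂ satisfying the matching conditions 1 + r₁ + r₂ = A₀, ik₁ − ir₁k₁ − ir₂k₂ = A₁, −k₁² − r₁k₁² − r₂k₂² = A₂, and −ik₁³ + ir₁k₁³ + ir₂k₂³ = A₃, if and only if the two transparent boundary conditions iA₂ − A₁(k₁ + k₂) − iA₀k₁k₂ + 2ik₁(k₁ + k₂) = 0 and iA₃ + iA₁(k₁² + k₂² + k₁k₂) − A₀k₁k₂(k₁ + k₂) + 2k₁k₂(k₁ + k₂) = 0 both hold. In that case r₁ and r₂ are uniquely determined and given by r₁ = (A₁ + ik₂A₀ − ik₂ − ik₁)/(ik₂ − ik₁) and r₂ = (−A₁ − ik₁A₀ + 2ik₁)/(ik₂ − ik₁). -/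
open Complex

/-- Transparent boundary conditions at `x = 0` for an electron injected from the left
(`p > 0`): existence of reflection coefficients `r₁, r₂` satisfying the matching
conditions is equivalent to the two transparent boundary conditions, and in that case
`r₁, r₂` are uniquely determined by the stated formulas. -/
theorem tbc_left_lead_p_pos (k1 k2 : ℝ) (hk1 : 0 < k1) (hk2 : 0 < k2) (hne : k1 ≠ k2)
    (A0 A1 A2 A3 : ℂ) :
    ((∃ r1 r2 : ℂ,
        1 + r1 + r2 = A0 ∧
        I * k1 - I * r1 * k1 - I * r2 * k2 = A1 ∧
        -(k1 : ℂ) ^ 2 - r1 * (k1 : ℂ) ^ 2 - r2 * (k2 : ℂ) ^ 2 = A2 ∧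
        -I * (k1 : ℂ) ^ 3 + I * r1 * (k1 : ℂ) ^ 3 + I * r2 * (k2 : ℂ) ^ 3 = A3) ↔
      (I * A2 - A1 * ((k1 : ℂ) + k2) - I * A0 * k1 * k2 + 2 * I * k1 * ((k1 : ℂ) + k2) = 0 ∧
       I * A3 + I * A1 * ((k1 : ℂ) ^ 2 + (k2 : ℂ) ^ 2 + k1 * k2)
          - A0 * k1 * k2 * ((k1 : ℂ) + k2) + 2 * k1 * k2 * ((k1 : ℂ) + k2) = 0)) ∧
    (∀ r1 r2 : ℂ,
        (1 + r1 + r2 = A0 ∧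
         I * k1 - I * r1 * k1 - I * r2 * k2 = A1 ∧
         -(k1 : ℂ) ^ 2 - r1 * (k1 : ℂ) ^ 2 - r2 * (k2 : ℂ) ^ 2 = A2 ∧
         -I * (k1 : ℂ) ^ 3 + I * r1 * (k1 : ℂ) ^ 3 + I * r2 * (k2 : ℂ) ^ 3 = A3) →
        r1 = (A1 + I * k2 * A0 - I * k2 - I * k1) / (I * k2 - I * k1) ∧
        r2 = (-A1 - I * k1 * A0 + 2 * I * k1) / (I * k2 - I * k1)) := by
  have hk : (k2 : ℂ) - k1 ≠ 0 := sub_ne_zero.mpr (by exact_mod_cast hne.symm)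
  have hD : I * (k2 : ℂ) - I * k1 ≠ 0 := by
    rw [← mul_sub]
    exact mul_ne_zero I_ne_zero hk
  refine ⟨⟨?_, ?_⟩, ?_⟩
  · rintro ⟨r1, r2, e0, e1, e2, e3⟩
    constructor
    · linear_combination -I * e2 + ((k1 : ℂ) + k2) * e1 + I * k1 * k2 * e0
    · linear_combination -I * e3 - I * ((k1 : ℂ) ^ 2 + (k2 : ℂ) ^ 2 + k1 * k2) * e1
        + (k1 : ℂ) * k2 * (k1 + k2) * e0
        + (-(k1 : ℂ) ^ 3 + r1 * (k1 : ℂ) ^ 3 + r2 * (k2 : ℂ) ^ 3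
          + ((k1 : ℂ) ^ 2 + (k2 : ℂ) ^ 2 + k1 * k2) * (k1 - r1 * k1 - r2 * k2)) * I_sq
  · rintro ⟨t1, t2⟩
    obtain ⟨r1, h1⟩ : ∃ r : ℂ, r * (I * k2 - I * k1) = A1 + I * k2 * A0 - I * k2 - I * k1 :=
      ⟨_, div_mul_cancel₀ _ hD⟩
    obtain ⟨r2, h2⟩ : ∃ r : ℂ, r * (I * k2 - I * k1) = -A1 - I * k1 * A0 + 2 * I * k1 :=
      ⟨_, div_mul_cancel₀ _ hD⟩
    have e0 : 1 + r1 + r2 = A0 := mul_right_cancel₀ hD (by linear_combination h1 + h2)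
    have e1 : I * k1 - I * r1 * k1 - I * r2 * k2 = A1 := by
      linear_combination h1 - I * k2 * e0
    refine ⟨r1, r2, e0, e1, ?_, ?_⟩
    · linear_combination I * t1 - I * ((k1 : ℂ) + k2) * e1 + (k1 : ℂ) * k2 * e0
        + (-(A2 - A0 * k1 * k2 + 2 * k1 * ((k1 : ℂ) + k2))
          + ((k1 : ℂ) + k2) * (k1 - r1 * k1 - r2 * k2)) * I_sq
    · linear_combination I * t2 - ((k1 : ℂ) ^ 2 + (k2 : ℂ) ^ 2 + k1 * k2) * e1
        - I * k1 * k2 * ((k1 : ℂ) + k2) * e0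
        - (A3 + A1 * ((k1 : ℂ) ^ 2 + (k2 : ℂ) ^ 2 + k1 * k2)) * I_sq
  · rintro r1 r2 ⟨e0, e1, -, -⟩
    rw [eq_div_iff hD, eq_div_iff hD]
    constructor
    · linear_combination e1 + I * k2 * e0
    · linear_combination -e1 - I * k1 * e0
end

section
/- Let k₃, k₄ be positive reals with k₃ ≠ k₄, let L > 0, and let A₀, A₁, A₂, A₃ ∈ ℂ (representing ψ(0), ψ'(0), ψ''(0), ψ'''(0)). There exist t₁, t₂ ∈ ℂ satisfying the matching conditions t₁e^{ik₃L} + t₂e^{ik₄L} = A₀, −ik₃t₁e^{ik₃L} − ik₄t₂e^{ik₄L} = A₁, −k₃²t₁e^{ik₃L} − k₄²t₂e^{ik₄L} = A₂, and ik₃³t₁e^{ik₃L} + ik₄³t₂e^{ik₄L} = A₃, if and only if the two transparent boundary conditions iA₂ − A₁(k₃ + k₄) − iA₀k₃k₄ = 0 and A₃ + A₁(k₃² + k₃k₄ + k₄²) + iA₀k₃k₄(k₃ + k₄) = 0 both hold. -/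
open Complex

/-- Transparent boundary conditions at `x = 0` for an electron injected from the right
(`p < 0`): existence of transmission coefficients `t₁, t₂` satisfying the matching
conditions is equivalent to the two transparent boundary conditions. -/
theorem tbc_left_lead_p_neg (k3 k4 L : ℝ) (hk3 : 0 < k3) (hk4 : 0 < k4) (hne : k3 ≠ k4)
    (hL : 0 < L) (A0 A1 A2 A3 : ℂ) :
    (∃ t1 t2 : ℂ,
        t1 * Complex.exp (I * k3 * L) + t2 * Complex.exp (I * k4 * L) = A0 ∧
        -I * k3 * t1 * Complex.exp (I * k3 * L) - I * k4 * t2 * Complex.exp (I * k4 * L) = A1 ∧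
        -(k3 : ℂ) ^ 2 * t1 * Complex.exp (I * k3 * L)
          - (k4 : ℂ) ^ 2 * t2 * Complex.exp (I * k4 * L) = A2 ∧
        I * (k3 : ℂ) ^ 3 * t1 * Complex.exp (I * k3 * L)
          + I * (k4 : ℂ) ^ 3 * t2 * Complex.exp (I * k4 * L) = A3) ↔
      (I * A2 - A1 * ((k3 : ℂ) + k4) - I * A0 * k3 * k4 = 0 ∧
       A3 + A1 * ((k3 : ℂ) ^ 2 + k3 * k4 + (k4 : ℂ) ^ 2)
          + I * A0 * k3 * k4 * ((k3 : ℂ) + k4) = 0) := by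
  have hE (k : ℝ) : Complex.exp (I * k * L) ≠ 0 := Complex.exp_ne_zero _
  have hd : (k3 : ℂ) - k4 ≠ 0 := sub_ne_zero.mpr (by exact_mod_cast hne)
  constructor
  · rintro ⟨t1, t2, rfl, rfl, rfl, rfl⟩
    constructor <;> ring
  · rintro ⟨h1, h2⟩
    obtain ⟨u, v, h0, hm⟩ : ∃ u v : ℂ, u + v = A0 ∧ k3 * u + k4 * v = I * A1 := by
      refine ⟨(I * A1 - k4 * A0) / (k3 - k4), (k3 * A0 - I * A1) / (k3 - k4), ?_, ?_⟩ <;>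
        field_simp <;> ring
    have hu := div_mul_cancel₀ u (hE k3)
    have hv := div_mul_cancel₀ v (hE k4)
    refine ⟨u / Complex.exp (I * k3 * L), v / Complex.exp (I * k4 * L), ?_, ?_, ?_, ?_⟩ <;>
      simp only [mul_assoc _ (_ / _), hu, hv]
    · exact h0
    · linear_combination -I * hm - A1 * I_sq
    · linear_combination I * h1 - (k3 + k4 : ℂ) * hm + k3 * k4 * h0 +
        (-A2 + A0 * k3 * k4) * I_sq
    · linear_combination -h2 + I * (k3 ^ 2 + k3 * k4 + k4 ^ 2 : ℂ) * hm -
        I * k3 * k4 * (k3 + k4) * h0 + A1 * (k3 ^ 2 + k3 * k4 + k4 ^ 2) * I_sq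
end

section
/- Let a < 0, ħ > 0, m > 0, q > 0, L > 0, let V ≡ 0, let k₁, k₂ > 0 with k₁ ≠ k₂ be the two positive roots of a k⁴ + (ħ²/(2m)) k² − E = 0 where E = (ħ²/(2m)) k₁² + a k₁⁴, and set k₃ = k₁, k₄ = k₂. Then the plane wave ψ(x) = e^{ik₁x} solves a ψ'''' − (ħ²/(2m)) ψ'' − E ψ = 0 on [0,L] and satisfies all four transparent boundary conditions: iψ''(0) − ψ'(0)(k₁+k₂) − iψ(0)k₁k₂ + 2ik₁(k₁+k₂) = 0, iψ'''(0) + iψ'(0)(k₁²+k₂²+k₁k₂) − ψ(0)k₁k₂(k₁+k₂) + 2k₁k₂(k₁+k₂) = 0, iψ''(L) + ψ'(L)(k₃+k₄) − iψ(L)k₃k₄ = 0, and ψ'''(L) + ψ'(L)(k₃²+k₄²+k₃k₄) − iψ(L)k₃k₄(k₃+k₄) = 0. -/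
open Complex

/-- The iterated derivatives of `x ↦ exp (c * x)` on the real line. -/
theorem iteratedDeriv_cexp_const_mul_ofReal (c : ℂ) (n : ℕ) :
    iteratedDeriv n (fun x : ℝ => Complex.exp (c * x)) =
      fun x : ℝ => c ^ n * Complex.exp (c * x) := by
  induction n with
  | zero => simp
  | succ n ih =>
    rw [iteratedDeriv_succ, ih]
    funext x
    have h : HasDerivAt (fun x : ℝ => c * (x : ℂ)) c x := by
      simpa using (Complex.ofRealCLM.hasDerivAt (x := x)).const_mul c
    rw [(h.cexp.const_mul (c ^ n)).deriv]
    ring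

/-- For constant potential `V ≡ 0`, the plane wave `ψ(x) = e^{ik₁x}` solves the
fourth-order Schrödinger equation on `[0, L]` and satisfies all four transparent
boundary conditions, where `k₁, k₂` are the two positive roots of the characteristic
quartic (with `E = (ħ²/(2m))k₁² + a k₁⁴`) and `k₃ = k₁`, `k₄ = k₂`. -/
theorem plane_wave_satisfies_tbc (a hb m q L E k1 k2 k3 k4 : ℝ)
    (ha : a < 0) (hhb : 0 < hb) (hm : 0 < m) (hq : 0 < q) (hL : 0 < L)
    (hk1 : 0 < k1) (hk2 : 0 < k2) (hne : k1 ≠ k2)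
    (hE : E = hb ^ 2 / (2 * m) * k1 ^ 2 + a * k1 ^ 4)
    (hroot1 : a * k1 ^ 4 + hb ^ 2 / (2 * m) * k1 ^ 2 - E = 0)
    (hroot2 : a * k2 ^ 4 + hb ^ 2 / (2 * m) * k2 ^ 2 - E = 0)
    (hk3 : k3 = k1) (hk4 : k4 = k2)
    (ψ : ℝ → ℂ) (hψ : ψ = fun x : ℝ => Complex.exp (I * k1 * x)) :
    (∀ x ∈ Set.Icc (0 : ℝ) L,
        (a : ℂ) * iteratedDeriv 4 ψ x - ((hb ^ 2 / (2 * m) : ℝ) : ℂ) * iteratedDeriv 2 ψ x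
          - (E : ℂ) * ψ x = 0) ∧
    (I * iteratedDeriv 2 ψ 0 - iteratedDeriv 1 ψ 0 * ((k1 : ℂ) + k2)
        - I * ψ 0 * k1 * k2 + 2 * I * k1 * ((k1 : ℂ) + k2) = 0) ∧
    (I * iteratedDeriv 3 ψ 0 + I * iteratedDeriv 1 ψ 0 * ((k1 : ℂ) ^ 2 + (k2 : ℂ) ^ 2 + k1 * k2)
        - ψ 0 * k1 * k2 * ((k1 : ℂ) + k2) + 2 * k1 * k2 * ((k1 : ℂ) + k2) = 0) ∧
    (I * iteratedDeriv 2 ψ L + iteratedDeriv 1 ψ L * ((k3 : ℂ) + k4)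
        - I * ψ L * k3 * k4 = 0) ∧
    (iteratedDeriv 3 ψ L + iteratedDeriv 1 ψ L * ((k3 : ℂ) ^ 2 + (k4 : ℂ) ^ 2 + k3 * k4)
        - I * ψ L * k3 * k4 * ((k3 : ℂ) + k4) = 0) := by
  subst hk3 hk4 hψ
  have hroot : (a : ℂ) * k3 ^ 4 + ((hb ^ 2 / (2 * m) : ℝ) : ℂ) * k3 ^ 2 - E = 0 := by
    exact_mod_cast hroot1
  have hI2 : I ^ 2 = -1 := I_sq
  have hI3 : I ^ 3 = -I := I_pow_three
  have hI4 : I ^ 4 = 1 := I_pow_four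
  simp only [iteratedDeriv_cexp_const_mul_ofReal, mul_pow, pow_one, hI2, hI3, hI4,
    ofReal_zero, mul_zero, Complex.exp_zero]
  refine ⟨fun x _ => ?_, ?_, ?_, ?_, ?_⟩
  · linear_combination Complex.exp (I * k3 * x) * hroot
  · ring
  · linear_combination (-(k3 : ℂ) ^ 3 + k3 * (k3 ^ 2 + k4 ^ 2 + k3 * k4)) * hI2
  · ring
  · ring
end

section
/- Let ħ > 0, m > 0, q > 0, α > 0 and a = −α ħ⁴/(4m²). Let V : ℝⁿ → ℝ and let Ψ : ℝⁿ × ℝ → ℂ be smooth and satisfy the time-dependent fourth-order Schrödinger equation iħ ∂_t Ψ = a Δ²Ψ − (ħ²/(2m)) ΔΨ − qVΨ. Then ∂_t |Ψ|² + ∇·J = 0, where the probability current density per unit charge is J = Im( (ħ/m) Ψ̄ ∇Ψ + (α ħ³/(2m²)) ( Ψ̄ ∇(ΔΨ) − (ΔΨ) ∇Ψ̄ ) ). -/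
/-- Partial derivative in the `i`-th coordinate direction of a complex-valued
function on `ℝⁿ`. -/
noncomputable def pd {n : ℕ} (i : Fin n) (f : (Fin n → ℝ) → ℂ) : (Fin n → ℝ) → ℂ :=
  fun x => fderiv ℝ f x (Pi.single i 1)

/-- Laplacian of a complex-valued function on `ℝⁿ`. -/
noncomputable def lap {n : ℕ} (f : (Fin n → ℝ) → ℂ) : (Fin n → ℝ) → ℂ :=
  fun x => ∑ i, pd i (pd i f) x

/-- Partial derivative in the `i`-th coordinate direction of a real-valued
function on `ℝⁿ`. -/
noncomputable def pdR {n : ℕ} (i : Fin n) (f : (Fin n → ℝ) → ℝ) : (Fin n → ℝ) → ℝ :=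
  fun x => fderiv ℝ f x (Pi.single i 1)

/-- Divergence of a real vector field on `ℝⁿ`. -/
noncomputable def dvgR {n : ℕ} (F : (Fin n → ℝ) → Fin n → ℝ) : (Fin n → ℝ) → ℝ :=
  fun x => ∑ i, pdR i (fun y => F y i) x

open scoped ContDiff ComplexConjugate

section PartialDerivatives

variable {n : ℕ} {f g : (Fin n → ℝ) → ℂ} {x : Fin n → ℝ}

theorem ContDiff.pd (i : Fin n) (hf : ContDiff ℝ ∞ f) : ContDiff ℝ ∞ (pd i f) :=
  (hf.fderiv_right (m := ∞) le_rfl).clm_apply contDiff_const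

theorem ContDiff.lap (hf : ContDiff ℝ ∞ f) : ContDiff ℝ ∞ (lap f) :=
  ContDiff.sum fun i _ => (hf.pd i).pd i

theorem ContDiff.star_comp (hf : ContDiff ℝ ∞ f) : ContDiff ℝ ∞ fun y => conj (f y) :=
  Complex.conjCLE.contDiff.comp hf

theorem pd_add (i : Fin n) (hf : DifferentiableAt ℝ f x) (hg : DifferentiableAt ℝ g x) :
    pd i (fun y => f y + g y) x = pd i f x + pd i g x := by
  simp [pd, fderiv_fun_add hf hg]

theorem pd_sub (i : Fin n) (hf : DifferentiableAt ℝ f x) (hg : DifferentiableAt ℝ g x) :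
    pd i (fun y => f y - g y) x = pd i f x - pd i g x := by
  simp [pd, fderiv_fun_sub hf hg]

theorem pd_mul (i : Fin n) (hf : DifferentiableAt ℝ f x) (hg : DifferentiableAt ℝ g x) :
    pd i (fun y => f y * g y) x = pd i f x * g x + f x * pd i g x := by
  simp [pd, fderiv_fun_mul hf hg]
  ring

theorem pd_const_mul (i : Fin n) (c : ℂ) (hf : DifferentiableAt ℝ f x) :
    pd i (fun y => c * f y) x = c * pd i f x := by
  simp [pd, fderiv_const_mul hf]

theorem pd_conj (i : Fin n) (hf : DifferentiableAt ℝ f x) :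
    pd i (fun y => conj (f y)) x = conj (pd i f x) := by
  have h : HasFDerivAt (fun y => conj (f y)) _ x :=
    Complex.conjCLE.hasFDerivAt.comp x hf.hasFDerivAt
  simp [pd, h.fderiv]

theorem pdR_im (i : Fin n) (hf : DifferentiableAt ℝ f x) :
    pdR i (fun y => (f y).im) x = (pd i f x).im := by
  have h : HasFDerivAt (fun y => (f y).im) _ x :=
    Complex.imCLM.hasFDerivAt.comp x hf.hasFDerivAt
  simp [pd, pdR, h.fderiv]

/-- The gradient terms of the divergence of the fourth-order probability current cancel. -/
theorem dvgR_current (c d : ℝ) (hf : ContDiff ℝ ∞ f) (x : Fin n → ℝ) :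
    dvgR (fun y i => ((c : ℂ) * (conj (f y) * pd i f y)
        + (d : ℂ) * (conj (f y) * pd i (lap f) y
          - lap f y * pd i (fun z => conj (f z)) y)).im) x
      = c * (conj (f x) * lap f x).im + d * (conj (f x) * lap (lap f) x).im := by
  have diff {g : (Fin n → ℝ) → ℂ} (hg : ContDiff ℝ ∞ g) : Differentiable ℝ g :=
    hg.differentiable (by simp)
  have key (i : Fin n) :
      pdR i (fun y => ((c : ℂ) * (conj (f y) * pd i f y)
        + (d : ℂ) * (conj (f y) * pd i (lap f) y
          - lap f y * pd i (fun z => conj (f z)) y)).im) x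
      = c * (conj (f x) * pd i (pd i f) x).im
        + d * (conj (f x) * pd i (pd i (lap f)) x - lap f x * conj (pd i (pd i f) x)).im := by
    have hconj : pd i (fun z => conj (f z)) = fun y => conj (pd i f y) :=
      funext fun y => pd_conj i (diff hf y)
    have h₀ := diff hf x
    have h₁ := diff hf.star_comp x
    have h₂ := diff (hf.pd i) x
    have h₃ := diff hf.lap x
    have h₄ := diff (hf.lap.pd i) x
    have h₅ := diff (hf.pd i).star_comp x
    have h₁₂ : DifferentiableAt ℝ (fun y => conj (f y) * pd i f y) x := h₁.mul h₂
    have h₁₄ : DifferentiableAt ℝ (fun y => conj (f y) * pd i (lap f) y) x := h₁.mul h₄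
    have h₃₅ : DifferentiableAt ℝ (fun y => lap f y * conj (pd i f y)) x := h₃.mul h₅
    have hsub : DifferentiableAt ℝ (fun y => conj (f y) * pd i (lap f) y
        - lap f y * conj (pd i f y)) x := h₁₄.sub h₃₅
    simp only [hconj]
    rw [pdR_im i ((h₁₂.const_mul (c : ℂ)).fun_add (hsub.const_mul (d : ℂ))),
      pd_add i (h₁₂.const_mul _) (hsub.const_mul _), pd_const_mul i _ h₁₂,
      pd_const_mul i _ hsub, pd_sub i h₁₄ h₃₅, pd_mul i h₁ h₂, pd_mul i h₁ h₄,
      pd_mul i h₃ h₅, pd_conj i h₀, pd_conj i h₂]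
    simp
    ring
  have hlap : (lap f x * conj (lap f x)).im = 0 := by
    rw [Complex.mul_conj, Complex.ofReal_im]
  calc _ = c * (conj (f x) * lap f x).im
        + d * (conj (f x) * lap (lap f) x - lap f x * conj (lap f x)).im := by
        simp only [dvgR, key, Finset.sum_add_distrib, ← Finset.mul_sum, ← Complex.im_sum,
          Finset.sum_sub_distrib, ← map_sum]
        rfl
    _ = _ := by rw [Complex.sub_im, hlap, sub_zero]

end PartialDerivatives

theorem HasDerivAt.complex_normSq {u : ℝ → ℂ} {u' : ℂ} {t : ℝ} (hu : HasDerivAt u u' t) :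
    HasDerivAt (fun s => Complex.normSq (u s)) (2 * (conj (u t) * u').re) t := by
  have hre : HasDerivAt (fun s => (u s).re) u'.re t :=
    Complex.reCLM.hasFDerivAt.comp_hasDerivAt t hu
  have him : HasDerivAt (fun s => (u s).im) u'.im t :=
    Complex.imCLM.hasFDerivAt.comp_hasDerivAt t hu
  refine HasDerivAt.congr_deriv ((hre.mul hre).add (him.mul him)) ?_
  simp
  ring

/-- Continuity equation for the time-dependent fourth-order Schrödinger equation
`iħ∂ₜΨ = aΔ²Ψ − (ħ²/(2m))ΔΨ − qVΨ` with `a = −αħ⁴/(4m²)`: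
`∂ₜ|Ψ|² + ∇·J = 0` where
`J = Im((ħ/m)Ψ̄∇Ψ + (αħ³/(2m²))(Ψ̄∇(ΔΨ) − (ΔΨ)∇Ψ̄))`. -/
theorem continuity_equation_SE4 {n : ℕ} (hb m q α : ℝ)
    (hhb : 0 < hb) (hm : 0 < m) (hq : 0 < q) (hα : 0 < α)
    (a : ℝ) (ha : a = -α * hb ^ 4 / (4 * m ^ 2))
    (V : (Fin n → ℝ) → ℝ) (Ψ : (Fin n → ℝ) → ℝ → ℂ)
    (hΨ : ContDiff ℝ (⊤ : ℕ∞) (fun p : (Fin n → ℝ) × ℝ => Ψ p.1 p.2))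
    (heq : ∀ (x : Fin n → ℝ) (t : ℝ),
      Complex.I * (hb : ℂ) * deriv (Ψ x) t =
        (a : ℂ) * lap (lap fun y => Ψ y t) x
          - ((hb ^ 2 / (2 * m) : ℝ) : ℂ) * lap (fun y => Ψ y t) x
          - ((q : ℝ) : ℂ) * ((V x : ℝ) : ℂ) * Ψ x t) :
    ∀ (x : Fin n → ℝ) (t : ℝ),
      deriv (fun s => Complex.normSq (Ψ x s)) t
        + dvgR (fun y i =>
            (((hb / m : ℝ) : ℂ) * ((starRingEnd ℂ) (Ψ y t) * pd i (fun z => Ψ z t) y)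
              + ((α * hb ^ 3 / (2 * m ^ 2) : ℝ) : ℂ) *
                  ((starRingEnd ℂ) (Ψ y t) * pd i (lap fun z => Ψ z t) y
                    - lap (fun z => Ψ z t) y * pd i (fun z => (starRingEnd ℂ) (Ψ z t)) y)).im) x
        = 0 := by
  intro x t
  have hspace : ContDiff ℝ ∞ fun y => Ψ y t :=
    hΨ.comp (contDiff_id.prodMk contDiff_const)
  have htime : ContDiff ℝ ∞ (Ψ x) :=
    hΨ.comp (contDiff_const.prodMk contDiff_id)
  have hderiv := (htime.differentiable (by simp) t).hasDerivAt.complex_normSq.deriv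
  rw [dvgR_current _ _ hspace, hderiv]
  have h := congrArg (fun z => (conj (Ψ x t) * z).im) (heq x t)
  generalize deriv (Ψ x) t = D at h ⊢
  generalize lap (lap fun y => Ψ y t) x = B at h ⊢
  generalize lap (fun y => Ψ y t) x = L at h ⊢
  have h' : hb * (conj (Ψ x t) * D).re
      = a * (conj (Ψ x t) * B).im - hb ^ 2 / (2 * m) * (conj (Ψ x t) * L).im := by
    simp [-Complex.ofReal_div, -Complex.ofReal_mul, -Complex.ofReal_pow] at h ⊢
    linear_combination h
  have hD : (conj (Ψ x t) * D).re
      = (a * (conj (Ψ x t) * B).im - hb ^ 2 / (2 * m) * (conj (Ψ x t) * L).im) / hb := by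
    rw [← h']
    field_simp
  rw [hD, ha]
  field_simp
  ring
end

section
/- Let ħ > 0, m > 0, q > 0, α > 0, a = −α ħ⁴/(4m²), E ∈ ℝ, and let V : [0,L] → ℝ be continuous. If ψ : [0,L] → ℂ is four times continuously differentiable and solves a ψ'''' − (ħ²/(2m)) ψ'' − (qV + E) ψ = 0 on [0,L], then the one-dimensional probability current J(x) = Im( (ħ/m) ψ̄(x)ψ'(x) + (α ħ³/(2m²)) ( ψ̄(x)ψ'''(x) − ψ̄'(x)ψ''(x) ) ) is constant on [0,L]. -/
open Set

/-- On a set of unique differentiability, the `k`-th iterated derivative within the set of a `Cⁿ`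
function with `k < n` has the `(k + 1)`-st one as its derivative. -/
theorem ContDiffOn.hasDerivWithinAt_iteratedDerivWithin {F : Type*} [NormedAddCommGroup F]
    [NormedSpace ℝ F] {f : ℝ → F} {s : Set ℝ} {n : WithTop ℕ∞} {k : ℕ} {x : ℝ}
    (hf : ContDiffOn ℝ n f s) (hk : (k : WithTop ℕ∞) < n) (hs : UniqueDiffOn ℝ s) (hx : x ∈ s) :
    HasDerivWithinAt (iteratedDerivWithin k f s) (iteratedDerivWithin (k + 1) f s x) s x := by
  rw [iteratedDerivWithin_succ]
  exact (hf.differentiableOn_iteratedDerivWithin hk hs x hx).hasDerivWithinAt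

/-- The imaginary part of `c₁ ψ̄ψ' + c₂ (ψ̄ψ''' - ψ̄'ψ'')` has derivative
`Im (ψ̄ (c₁ ψ'' + c₂ ψ''''))`. -/
theorem hasDerivWithinAt_im_current {f₀ f₁ f₂ f₃ : ℝ → ℂ} {d₄ : ℂ} {s : Set ℝ} {x : ℝ}
    (c₁ c₂ : ℝ) (h₀ : HasDerivWithinAt f₀ (f₁ x) s x) (h₁ : HasDerivWithinAt f₁ (f₂ x) s x)
    (h₂ : HasDerivWithinAt f₂ (f₃ x) s x) (h₃ : HasDerivWithinAt f₃ d₄ s x) :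
    HasDerivWithinAt
      (fun y => ((c₁ : ℂ) * ((starRingEnd ℂ) (f₀ y) * f₁ y)
        + (c₂ : ℂ) * ((starRingEnd ℂ) (f₀ y) * f₃ y - (starRingEnd ℂ) (f₁ y) * f₂ y)).im)
      ((starRingEnd ℂ) (f₀ x) * (c₁ * f₂ x + c₂ * d₄)).im s x := by
  have conj₀ : HasDerivWithinAt (fun y => (starRingEnd ℂ) (f₀ y)) ((starRingEnd ℂ) (f₁ x)) s x :=
    h₀.star
  have conj₁ : HasDerivWithinAt (fun y => (starRingEnd ℂ) (f₁ y)) ((starRingEnd ℂ) (f₂ x)) s x :=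
    h₁.star
  have key := Complex.imCLM.hasFDerivAt.comp_hasDerivWithinAt x
    (((conj₀.mul h₁).const_mul (c₁ : ℂ)).add
      (((conj₀.mul h₃).sub (conj₁.mul h₂)).const_mul (c₂ : ℂ)))
  refine key.congr_deriv ?_
  simp
  ring

/-- For a `C⁴` solution `ψ` of the fourth-order stationary Schrödinger equation
`a ψ'''' − (ħ²/(2m))ψ'' − (qV + E)ψ = 0` on `[0, L]` with `a = −αħ⁴/(4m²)` and `V`
continuous, the one-dimensional probability current
`J = Im((ħ/m)ψ̄ψ' + (αħ³/(2m²))(ψ̄ψ''' − ψ̄'ψ''))` is constant on `[0, L]`. -/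
theorem current_constant_SE4 (hb m q α E L : ℝ)
    (hhb : 0 < hb) (hm : 0 < m) (hq : 0 < q) (hα : 0 < α) (hL : 0 < L)
    (a : ℝ) (ha : a = -α * hb ^ 4 / (4 * m ^ 2))
    (V : ℝ → ℝ) (hV : ContinuousOn V (Icc 0 L))
    (ψ : ℝ → ℂ) (hψ : ContDiffOn ℝ 4 ψ (Icc 0 L))
    (hode : ∀ x ∈ Icc (0 : ℝ) L,
      (a : ℂ) * iteratedDerivWithin 4 ψ (Icc 0 L) x
        - ((hb ^ 2 / (2 * m) : ℝ) : ℂ) * iteratedDerivWithin 2 ψ (Icc 0 L) x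
        - ((q * V x + E : ℝ) : ℂ) * ψ x = 0) :
    ∀ x ∈ Icc (0 : ℝ) L, ∀ y ∈ Icc (0 : ℝ) L,
      (((hb / m : ℝ) : ℂ) * ((starRingEnd ℂ) (ψ x) * iteratedDerivWithin 1 ψ (Icc 0 L) x)
        + ((α * hb ^ 3 / (2 * m ^ 2) : ℝ) : ℂ) *
            ((starRingEnd ℂ) (ψ x) * iteratedDerivWithin 3 ψ (Icc 0 L) x
              - (starRingEnd ℂ) (iteratedDerivWithin 1 ψ (Icc 0 L) x)
                  * iteratedDerivWithin 2 ψ (Icc 0 L) x)).im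
      =
      (((hb / m : ℝ) : ℂ) * ((starRingEnd ℂ) (ψ y) * iteratedDerivWithin 1 ψ (Icc 0 L) y)
        + ((α * hb ^ 3 / (2 * m ^ 2) : ℝ) : ℂ) *
            ((starRingEnd ℂ) (ψ y) * iteratedDerivWithin 3 ψ (Icc 0 L) y
              - (starRingEnd ℂ) (iteratedDerivWithin 1 ψ (Icc 0 L) y)
                  * iteratedDerivWithin 2 ψ (Icc 0 L) y)).im := by
  have hs : UniqueDiffOn ℝ (Icc 0 L) := uniqueDiffOn_Icc hL
  have hderiv : ∀ k : ℕ, k < 4 → ∀ x ∈ Icc 0 L, HasDerivWithinAt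
      (iteratedDerivWithin k ψ (Icc 0 L)) (iteratedDerivWithin (k + 1) ψ (Icc 0 L) x)
      (Icc 0 L) x := fun k hk x hx =>
    hψ.hasDerivWithinAt_iteratedDerivWithin (by exact_mod_cast hk) hs hx
  have hJ : ∀ x ∈ Icc 0 L, HasDerivWithinAt
      (fun y => (((hb / m : ℝ) : ℂ) *
          ((starRingEnd ℂ) (ψ y) * iteratedDerivWithin 1 ψ (Icc 0 L) y)
        + ((α * hb ^ 3 / (2 * m ^ 2) : ℝ) : ℂ) *
            ((starRingEnd ℂ) (ψ y) * iteratedDerivWithin 3 ψ (Icc 0 L) y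
              - (starRingEnd ℂ) (iteratedDerivWithin 1 ψ (Icc 0 L) y)
                  * iteratedDerivWithin 2 ψ (Icc 0 L) y)).im) 0 (Icc 0 L) x := by
    intro x hx
    have h₀ := hderiv 0 (by norm_num) x hx
    rw [iteratedDerivWithin_zero] at h₀
    refine (hasDerivWithinAt_im_current _ _ h₀ (hderiv 1 (by norm_num) x hx)
      (hderiv 2 (by norm_num) x hx) (hderiv 3 (by norm_num) x hx)).congr_deriv ?_
    have hode' : ((hb / m : ℝ) : ℂ) * iteratedDerivWithin 2 ψ (Icc 0 L) x
        + ((α * hb ^ 3 / (2 * m ^ 2) : ℝ) : ℂ) * iteratedDerivWithin 4 ψ (Icc 0 L) x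
        = ((-2 / hb * (q * V x + E) : ℝ) : ℂ) * ψ x := by
      have h₁ : hb / m = -2 / hb * -(hb ^ 2 / (2 * m)) := by field_simp
      have h₂ : α * hb ^ 3 / (2 * m ^ 2) = -2 / hb * a := by
        rw [ha]
        field_simp
        norm_num
      rw [h₁, h₂, Complex.ofReal_mul, Complex.ofReal_mul, Complex.ofReal_mul, Complex.ofReal_neg]
      linear_combination ((-2 / hb : ℝ) : ℂ) * hode x hx
    rw [hode', mul_left_comm, ← Complex.normSq_eq_conj_mul_self, ← Complex.ofReal_mul,
      Complex.ofReal_im]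
  have hconst := constant_of_derivWithin_zero (fun x hx => (hJ x hx).differentiableWithinAt)
    fun x hx => (hJ x (Ico_subset_Icc_self hx)).derivWithin (hs x (Ico_subset_Icc_self hx))
  exact fun x hx y hy => (hconst x hx).trans (hconst y hy).symm
end
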